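/- Let 0 < c ≤ 1 be a real number, let X be a finite set of N points in ℝ² in general position containing a subset Y ⊆ X with |Y| ≥ c·N, |Y| ≥ 3, and Y in convex position, and let K ≥ 1 be an integer. Then: (i) for every set L of K affine lines in ℝ², each disjoint from X, some cell of L contains at least c·N/(2K) points of X; and (ii) there exists a set of K distinct affine lines, each disjoint from X, such that every cell contains at most ⌈N/(2K)⌉ points of X. -/

import Mathlib

open Set

/-- Points of the plane. -/
abbrev Pt := ℝ × ℝ

/-- An affine line in ℝ², given by a nontrivial linear equation. -/
def IsAffLine (l : Set Pt) : Prop :=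
  ∃ a b c : ℝ, (a ≠ 0 ∨ b ≠ 0) ∧ l = {p : Pt | a * p.1 + b * p.2 = c}

/-- An open half-plane in ℝ². -/
def IsOpenHalfPlane (H : Set Pt) : Prop :=
  ∃ a b c : ℝ, (a ≠ 0 ∨ b ≠ 0) ∧ H = {p : Pt | a * p.1 + b * p.2 < c}

/-- `A` and `B` are linearly separable: some affine line has `A` strictly on
one side and `B` strictly on the other side. -/
def LinSep (A B : Set Pt) : Prop :=
  ∃ a b c : ℝ, (a ≠ 0 ∨ b ≠ 0) ∧ (∀ p ∈ A, a * p.1 + b * p.2 < c) ∧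
    (∀ p ∈ B, c < a * p.1 + b * p.2)

/-- General position: no three (distinct) points of `X` are collinear. -/
def GenPos (X : Set Pt) : Prop :=
  ∀ p ∈ X, ∀ q ∈ X, ∀ r ∈ X, p ≠ q → p ≠ r → q ≠ r →
    ¬ Collinear ℝ ({p, q, r} : Set Pt)

/-- Convex position: no point of `X` lies in the convex hull of the others. -/
def ConvexPos (X : Set Pt) : Prop :=
  ∀ p ∈ X, p ∉ convexHull ℝ (X \ {p})

/-- A cell of an arrangement `L` of lines: a connected component of the
complement of the union of the lines. -/
def IsCell (L : Set (Set Pt)) (cell : Set Pt) : Prop :=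
  ∃ p ∈ (⋃₀ L)ᶜ, cell = connectedComponentIn (⋃₀ L)ᶜ p

/-- `S` has at most `d` connected components: among any `d + 1` points of `S`,
two lie in the same connected component of `S`. -/
def CompsLE (S : Set Pt) (d : ℕ) : Prop :=
  ∀ f : Fin (d + 1) → Pt, (∀ i, f i ∈ S) →
    ∃ i j, i ≠ j ∧ connectedComponentIn S (f i) = connectedComponentIn S (f j)

/-- A Jordan curve: the image of a continuous injective map from the unit
circle to the plane. -/
def IsJordanCurve (J : Set Pt) : Prop :=
  ∃ f : EuclideanSpace ℝ (Fin 2) → Pt,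
    ContinuousOn f (Metric.sphere 0 1) ∧ Set.InjOn f (Metric.sphere 0 1) ∧
      J = f '' (Metric.sphere 0 1)

/-- `J` has stabbing number at most `d` (a natural number): every affine line
meets `J` in at most `d` connected components. -/
def StabLE (J : Set Pt) (d : ℕ) : Prop :=
  ∀ l, IsAffLine l → CompsLE (J ∩ l) d

/-- `J` has stabbing number at most a real number `d`: every affine line meets
`J` in at most `⌊d⌋₊` connected components. -/
def StabLER (J : Set Pt) (d : ℝ) : Prop :=
  ∀ l, IsAffLine l → CompsLE (J ∩ l) ⌊d⌋₊

/-- Twice the signed area of a triangle. -/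
def orient (p q r : Pt) : ℝ := (q.1 - p.1) * (r.2 - p.2) - (q.2 - p.2) * (r.1 - p.1)

lemma collinear_of_orient {p q r : Pt} (hpq : p ≠ q) (h : orient p q r = 0) :
    Collinear ℝ ({p, q, r} : Set Pt) := by
  unfold orient at h
  rw [collinear_iff_of_mem (p₀ := p) (by simp)]
  refine ⟨q - p, ?_⟩
  have key : ∃ t : ℝ, r.1 = t * (q.1 - p.1) + p.1 ∧ r.2 = t * (q.2 - p.2) + p.2 := by
    by_cases h1 : q.1 - p.1 = 0
    · have h2 : q.2 - p.2 ≠ 0 := by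
        intro h2
        exact hpq (Prod.ext (by linarith) (by linarith))
      refine ⟨(r.2 - p.2) / (q.2 - p.2), ?_, ?_⟩
      · rw [h1] at h ⊢
        have : (q.2 - p.2) * (r.1 - p.1) = 0 := by linarith
        rcases mul_eq_zero.1 this with h3 | h3
        · exact absurd h3 h2
        · linarith
      · field_simp
        ring
    · refine ⟨(r.1 - p.1) / (q.1 - p.1), ?_, ?_⟩
      · field_simp
        ring
      · field_simp
        linarith
  intro x hx
  simp only [mem_insert_iff, mem_singleton_iff] at hx
  rcases hx with rfl | rfl | rfl
  · exact ⟨0, by simp⟩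
  · exact ⟨1, by simp⟩
  · obtain ⟨t, h1, h2⟩ := key
    exact ⟨t, Prod.ext (by simpa using h1) (by simpa using h2)⟩

lemma GenPos.orient_ne {X : Set Pt} (hX : GenPos X) {p q r : Pt} (hp : p ∈ X) (hq : q ∈ X)
    (hr : r ∈ X) (hpq : p ≠ q) (hpr : p ≠ r) (hqr : q ≠ r) : orient p q r ≠ 0 := fun h =>
  hX p hp q hq r hr hpq hpr hqr (collinear_of_orient hpq h)

lemma GenPos.not_on_line {X : Set Pt} (hX : GenPos X) {p q r : Pt} (hp : p ∈ X) (hq : q ∈ X)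
    (hr : r ∈ X) (hpq : p ≠ q) (hpr : p ≠ r) (hqr : q ≠ r) {a b c : ℝ} (hab : a ≠ 0 ∨ b ≠ 0)
    (h1 : a * p.1 + b * p.2 = c) (h2 : a * q.1 + b * q.2 = c) (h3 : a * r.1 + b * r.2 = c) :
    False := by
  refine hX.orient_ne hp hq hr hpq hpr hqr ?_
  have ha : a * orient p q r = 0 := by
    unfold orient
    linear_combination (r.2 - p.2) * (h2 - h1) - (q.2 - p.2) * (h3 - h1)
  have hb : b * orient p q r = 0 := by
    unfold orient
    linear_combination (q.1 - p.1) * (h3 - h1) - (r.1 - p.1) * (h2 - h1)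
  rcases hab with h | h
  · exact (mul_eq_zero.1 ha).resolve_left h
  · exact (mul_eq_zero.1 hb).resolve_left h

/-- The next vertex in counterclockwise order. -/
lemma exists_next {R : Finset Pt} (hg : GenPos ↑R) (hc : ConvexPos ↑R) (h2 : 2 ≤ R.card)
    {p : Pt} (hp : p ∈ R) :
    ∃ q ∈ R, q ≠ p ∧ ∀ r ∈ R, r ≠ p → r ≠ q → 0 < orient p q r := by
  classical
  obtain ⟨f, u, hfp, hf⟩ := geometric_hahn_banach_point_closed (convex_convexHull ℝ _)
    (Set.Finite.isClosed_convexHull ℝ (R.finite_toSet.subset diff_subset)) (hc p hp)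
  have hfr : ∀ r ∈ R, r ≠ p → f p < f r := fun r hr hrp =>
    hfp.trans (hf r (subset_convexHull ℝ _ ⟨hr, by simpa using hrp⟩))
  set α := f (1, 0) with hα
  set β := f (0, 1) with hβ
  have hfx : ∀ x : Pt, f x = α * x.1 + β * x.2 := by
    intro x
    have : x = x.1 • ((1, 0) : Pt) + x.2 • ((0, 1) : Pt) := by
      ext <;> simp
    conv_lhs => rw [this]
    rw [map_add, map_smul, map_smul, smul_eq_mul, smul_eq_mul, ← hα, ← hβ]
    ring
  have hne : (R.erase p).Nonempty := by
    rw [← Finset.card_pos, Finset.card_erase_of_mem hp]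
    omega
  obtain ⟨q, hq, hmin⟩ := Finset.exists_min_image (R.erase p)
    (fun r => (α * (r.2 - p.2) - β * (r.1 - p.1)) / (f r - f p)) hne
  rw [Finset.mem_erase] at hq
  refine ⟨q, hq.2, hq.1, fun r hr hrp hrq => ?_⟩
  have h := hmin r (Finset.mem_erase.2 ⟨hrp, hr⟩)
  have hq0 := sub_pos.2 (hfr q hq.2 hq.1)
  have hr0 := sub_pos.2 (hfr r hr hrp)
  rw [div_le_div_iff₀ hq0 hr0] at h
  have hn := hg.orient_ne hp hq.2 hr hq.1.symm hrp.symm hrq.symm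
  have hid : (α * (r.2 - p.2) - β * (r.1 - p.1)) * (f q - f p)
      - (α * (q.2 - p.2) - β * (q.1 - p.1)) * (f r - f p) = (α ^ 2 + β ^ 2) * orient p q r := by
    rw [hfx, hfx, hfx]
    unfold orient
    ring
  have hge : 0 ≤ (α ^ 2 + β ^ 2) * orient p q r := by linarith
  have hpos : 0 < α ^ 2 + β ^ 2 := by
    rcases lt_or_eq_of_le (by positivity : 0 ≤ α ^ 2 + β ^ 2) with h | h
    · exact h
    · have ha : α = 0 := by nlinarith [sq_nonneg α, sq_nonneg β]
      have hb : β = 0 := by nlinarith [sq_nonneg α, sq_nonneg β]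
      rw [hfx, hfx p, ha, hb] at hq0
      simp at hq0
  exact lt_of_le_of_ne (nonneg_of_mul_nonneg_right hge hpos) hn.symm

/-- A line is crossed in a given direction by at most one hull edge. -/
lemma cross_unique {p q p' q' : Pt} {a b c : ℝ}
    (hp : a * p.1 + b * p.2 < c) (hq : c < a * q.1 + b * q.2)
    (hp' : a * p'.1 + b * p'.2 < c) (hq' : c < a * q'.1 + b * q'.2)
    (h1 : 0 < orient p q p') (h2 : 0 ≤ orient p q q')
    (h3 : 0 < orient p' q' p) (h4 : 0 ≤ orient p' q' q) : False := by
  have e : (a * q'.1 + b * q'.2 - c) * orient p q p' + (c - (a * p'.1 + b * p'.2)) * orient p q q'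
    + (a * q.1 + b * q.2 - c) * orient p' q' p + (c - (a * p.1 + b * p.2)) * orient p' q' q = 0 := by
    unfold orient
    ring
  have := mul_pos (sub_pos.2 hq') h1
  have := mul_nonneg (sub_pos.2 hp').le h2
  have := mul_pos (sub_pos.2 hq) h3
  have := mul_nonneg (sub_pos.2 hp).le h4
  linarith

lemma cross_unique' {R : Finset Pt} {nx : Pt → Pt} (hnx : ∀ p ∈ R, nx p ∈ R ∧ nx p ≠ p ∧
    ∀ r ∈ R, r ≠ p → r ≠ nx p → 0 < orient p (nx p) r) {p p' : Pt} (hpR : p ∈ R) (hpR' : p' ∈ R)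
    {a b c : ℝ} (hp : a * p.1 + b * p.2 < c) (hq : c < a * (nx p).1 + b * (nx p).2)
    (hp' : a * p'.1 + b * p'.2 < c) (hq' : c < a * (nx p').1 + b * (nx p').2) : p = p' := by
  by_contra hne
  have n1 : p' ≠ nx p := by
    intro h
    rw [← h] at hq
    linarith
  have n2 : p ≠ nx p' := by
    intro h
    rw [← h] at hq'
    linarith
  have n3 : nx p' ≠ p := n2.symm
  have n4 : nx p ≠ p' := n1.symm
  obtain ⟨a1, a2, a3⟩ := hnx p hpR
  obtain ⟨b1, b2, b3⟩ := hnx p' hpR'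
  refine cross_unique hp hq hp' hq' (a3 _ hpR' (Ne.symm hne) n1) ?_ (b3 _ hpR hne n2) ?_
  · by_cases h : nx p' = nx p
    · rw [h]
      unfold orient
      apply le_of_eq
      ring
    · exact (a3 _ b1 n3 h).le
  · by_cases h : nx p = nx p'
    · rw [h]
      unfold orient
      apply le_of_eq
      ring
    · exact (b3 _ a1 n4 h).le

/-- Points in convex position, any two separated by one of `K` lines: at most `2K`. -/
lemma card_le_of_separated {R : Finset Pt} (hg : GenPos ↑R) (hc : ConvexPos ↑R) 
    {L : Finset (Set Pt)} (hL : 1 ≤ L.card) (a b c : Set Pt → ℝ)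
    (hon : ∀ l ∈ L, ∀ p ∈ R, a l * p.1 + b l * p.2 ≠ c l)
    (hsep : ∀ p ∈ R, ∀ q ∈ R, p ≠ q → ∃ l ∈ L,
      ¬ (a l * p.1 + b l * p.2 < c l ↔ a l * q.1 + b l * q.2 < c l)) :
    R.card ≤ 2 * L.card := by
  classical
  by_cases h2 : 2 ≤ R.card
  swap
  · omega
  have hn : ∀ p : Pt, ∃ q : Pt, p ∈ R → (q ∈ R ∧ q ≠ p ∧
      ∀ r ∈ R, r ≠ p → r ≠ q → 0 < orient p q r) := by
    intro p
    by_cases hp : p ∈ R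
    · obtain ⟨q, hq⟩ := exists_next hg hc h2 hp
      exact ⟨q, fun _ => ⟨hq.1, hq.2.1, hq.2.2⟩⟩
    · exact ⟨p, fun h => absurd h hp⟩
  choose nx hnx using hn
  have hs : ∀ p : Pt, ∃ l : Set Pt, p ∈ R → (l ∈ L ∧
      ¬ (a l * p.1 + b l * p.2 < c l ↔ a l * (nx p).1 + b l * (nx p).2 < c l)) := by
    intro p
    by_cases hp : p ∈ R
    · obtain ⟨l, hl⟩ := hsep p hp (nx p) (hnx p hp).1 (hnx p hp).2.1.symm
      exact ⟨l, fun _ => hl⟩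
    · exact ⟨∅, fun h => absurd h hp⟩
  choose ln hln using hs
  let F : Pt → Set Pt × Bool := fun p => (ln p, decide (a (ln p) * p.1 + b (ln p) * p.2 < c (ln p)))
  have hF : (R : Set Pt).InjOn F := by
    intro p hp p' hp' h
    simp only [F, Prod.mk.injEq] at h
    obtain ⟨hl, hd⟩ := h
    have hp : p ∈ R := hp
    have hp' : p' ∈ R := hp'
    obtain ⟨l1, s1⟩ := hln p hp
    obtain ⟨l2, s2⟩ := hln p' hp'
    rw [← hl] at s2 hd
    have hd := decide_eq_decide.1 hd
    set l := ln p
    have o1 := hon l l1 p hp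
    have o2 := hon l l1 p' hp'
    have o3 := hon l l1 _ (hnx p hp).1
    have o4 := hon l l1 _ (hnx p' hp').1
    by_cases hlt : a l * p.1 + b l * p.2 < c l
    · have hlt' := hd.1 hlt
      simp only [hlt, hlt', true_iff, not_lt] at s1 s2
      exact cross_unique' hnx hp hp' hlt (lt_of_le_of_ne s1 o3.symm) hlt'
        (lt_of_le_of_ne s2 o4.symm)
    · have hlt' : ¬ a l * p'.1 + b l * p'.2 < c l := fun h => hlt (hd.2 h)
      simp only [hlt, hlt', false_iff, not_not] at s1 s2
      have g1 := lt_of_le_of_ne (not_lt.1 hlt) o1.symm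
      have g2 := lt_of_le_of_ne (not_lt.1 hlt') o2.symm
      exact cross_unique' hnx hp hp' (a := - a l) (b := - b l) (c := - c l)
        (by linarith) (by linarith) (by linarith) (by linarith)
  have := Finset.card_le_card_of_injOn F (t := L ×ˢ Finset.univ)
    (fun p hp => by
      have h := (hln p hp).1
      simp only [F, Finset.coe_product, mem_prod]
      exact ⟨h, Finset.mem_coe.2 (Finset.mem_univ _)⟩) hF
  rw [Finset.card_product] at this
  simp at this
  omega

lemma part_one (c : ℝ) (X Y : Finset Pt) (N : ℕ)
    (hgp : GenPos ↑X) (hYX : Y ⊆ X)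
    (hYc : c * N ≤ (Y.card : ℝ)) (hY3 : 3 ≤ Y.card) (hcp : ConvexPos ↑Y)
    (K : ℕ) (hK : 1 ≤ K) (L : Finset (Set Pt)) (hLK : L.card = K)
    (hL : ∀ l ∈ L, IsAffLine l ∧ Disjoint l (↑X : Set Pt)) :
    ∃ cell, IsCell ↑L cell ∧
          c * N / (2 * K) ≤ ((((↑X : Set Pt) ∩ cell).ncard : ℝ)) := by
  classical
  have h1 : ∀ l : Set Pt, ∃ a b c : ℝ, l ∈ L → l = {p : Pt | a * p.1 + b * p.2 = c} := by
    intro l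
    by_cases hl : l ∈ L
    · obtain ⟨a, b, c, -, h⟩ := (hL l hl).1
      exact ⟨a, b, c, fun _ => h⟩
    · exact ⟨0, 0, 0, fun h => absurd h hl⟩
  choose a b d habd using h1
  have hon : ∀ l ∈ L, ∀ p ∈ X, a l * p.1 + b l * p.2 ≠ d l := by
    intro l hl p hp h
    have hpl : p ∈ l := by
      rw [habd l hl]
      exact h
    exact Set.disjoint_left.1 (hL l hl).2 hpl hp
  have hcompl : ∀ p ∈ X, p ∈ (⋃₀ (↑L : Set (Set Pt)))ᶜ := by
    rintro p hp ⟨l, hl, hpl⟩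
    exact Set.disjoint_left.1 (hL l hl).2 hpl hp
  let F : Pt → Set Pt := fun p => connectedComponentIn (⋃₀ (↑L : Set (Set Pt)))ᶜ p
  -- same side of all lines gives the same component
  have hF : ∀ p ∈ X, ∀ q ∈ X, (∀ l ∈ L, (a l * p.1 + b l * p.2 < d l ↔
      a l * q.1 + b l * q.2 < d l)) → F p = F q := by
    intro p hp q hq h
    have hseg : segment ℝ p q ⊆ (⋃₀ (↑L : Set (Set Pt)))ᶜ := by
      rintro x ⟨s, t, hs, ht, hst, rfl⟩ ⟨l, hl, hx⟩
      have hl : l ∈ L := hl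
      rw [habd l hl] at hx
      simp only [mem_setOf_eq, Prod.fst_add, Prod.snd_add, Prod.smul_fst, Prod.smul_snd,
        smul_eq_mul] at hx
      have op := hon l hl p hp
      have oq := hon l hl q hq
      have hh := h l hl
      have hx' : s * (a l * p.1 + b l * p.2 - d l) + t * (a l * q.1 + b l * q.2 - d l) = 0 := by
        linear_combination hx - d l * hst
      by_cases hlt : a l * p.1 + b l * p.2 < d l
      · have hlt' := hh.1 hlt
        rcases hs.eq_or_lt with h0 | h0
        · have : t = 1 := by linarith
          subst this
          rw [← h0] at hx'
          linarith
        · nlinarith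
      · have g1 := lt_of_le_of_ne (not_lt.1 hlt) op.symm
        have g2 := lt_of_le_of_ne (not_lt.1 (fun h => hlt (hh.2 h))) oq.symm
        rcases hs.eq_or_lt with h0 | h0
        · have : t = 1 := by linarith
          subst this
          rw [← h0] at hx'
          linarith
        · nlinarith
    apply connectedComponentIn_eq
    exact (convex_segment p q).isPreconnected.subset_connectedComponentIn
      (left_mem_segment ℝ p q) hseg (right_mem_segment ℝ p q)
  obtain ⟨R, hRY, hinj, himg⟩ := Finset.exists_subset_injOn_image_eq_of_surjOn (f := F)
    (↑Y : Set Pt) (Y.image F) (by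
      intro x hx
      simpa using hx)
  have hRY' : R ⊆ Y := by exact_mod_cast hRY
  have hRX : R ⊆ X := hRY'.trans hYX
  have hRcard : R.card ≤ 2 * L.card := by
    refine card_le_of_separated (fun p hp q hq r hr => hgp p (hRX hp) q (hRX hq) r (hRX hr))
      ?_ (by omega) a b d (fun l hl p hp => hon l hl p (hRX hp)) ?_
    · intro p hp h
      exact hcp p (hRY' hp) (convexHull_mono (diff_subset_diff_left hRY) h)
    · intro p hp q hq hne
      by_contra hcon
      push Not at hcon
      exact hne (hinj hp hq (hF p (hRX hp) q (hRX hq) hcon))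
  have hScard : (Y.image F).card ≤ 2 * K := by
    rw [← himg, Finset.card_image_of_injOn hinj]
    omega
  have hYne : Y.Nonempty := by
    rw [← Finset.card_pos]
    omega
  have hK0 : (0 : ℝ) < 2 * K := by
    have : (1 : ℝ) ≤ K := by exact_mod_cast hK
    linarith
  obtain ⟨y, hy, hle⟩ := Finset.exists_le_card_fiber_of_nsmul_le_card_of_maps_to (s := Y)
    (t := Y.image F) (f := F) (b := (Y.card : ℝ) / (2 * K))
    (fun p hp => Finset.mem_image_of_mem _ hp) (hYne.image _) (by
      rw [nsmul_eq_mul, mul_div_assoc', div_le_iff₀ hK0, mul_comm]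
      gcongr
      exact_mod_cast hScard)
  obtain ⟨p, hp, rfl⟩ := Finset.mem_image.1 hy
  refine ⟨F p, ⟨p, hcompl p (hYX hp), rfl⟩, ?_⟩
  calc c * N / (2 * K) ≤ (Y.card : ℝ) / (2 * K) := by gcongr
    _ ≤ _ := hle
    _ ≤ _ := by
      norm_cast
      rw [← Set.ncard_coe_finset]
      refine Set.ncard_le_ncard ?_ (X.finite_toSet.inter_of_left _)
      intro q hq
      simp only [Finset.coe_filter, mem_setOf_eq] at hq
      refine ⟨hYX hq.1, ?_⟩
      rw [← hq.2]
      exact mem_connectedComponentIn (hcompl q (hYX hq.1))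

lemma exists_gap (X : Finset Pt) (u : Pt → ℝ) (t : ℝ) :
    ∃ t', t < t' ∧ ∀ p ∈ X, t < u p → t' < u p := by
  have : ∀ᶠ t' in nhdsWithin t (Ioi t), ∀ p ∈ X, t < u p → t' < u p := by
    rw [Filter.eventually_all_finset]
    intro p _
    by_cases h : t < u p
    · filter_upwards [mem_nhdsWithin_of_mem_nhds (Iio_mem_nhds h)] with s hs _
      exact hs
    · exact Filter.Eventually.of_forall fun _ h' => absurd h' h
  obtain ⟨t', h1, h2⟩ := (this.and self_mem_nhdsWithin).exists
  exact ⟨t', h2, h1⟩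

lemma exists_thr (X : Finset Pt) (u : Pt → ℝ) (hu : (X : Set Pt).InjOn u) (j : ℕ)
    (hj : j ≤ X.card) : ∃ t, (X.filter (fun p => u p < t)).card = j ∧ ∀ p ∈ X, u p ≠ t := by
  classical
  induction j with
  | zero =>
    have : ∀ᶠ t in Filter.atBot, ∀ p ∈ X, t < u p := by
      rw [Filter.eventually_all_finset]
      intro p _
      exact Filter.eventually_lt_atBot _
    obtain ⟨t, ht⟩ := this.exists
    refine ⟨t, ?_, fun p hp => (ht p hp).ne'⟩
    rw [Finset.card_eq_zero, Finset.filter_eq_empty_iff]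
    exact fun p hp => not_lt.2 (ht p hp).le
  | succ j ih =>
    obtain ⟨t, h1, h2⟩ := ih (by omega)
    have hne : (X.filter (fun p => ¬ u p < t)).Nonempty := by
      rw [← Finset.card_pos]
      have := Finset.card_filter_add_card_filter_not (s := X) (fun p => u p < t)
      omega
    obtain ⟨q, hq, hmin⟩ := Finset.exists_min_image _ u hne
    rw [Finset.mem_filter] at hq
    obtain ⟨t', ht', hgap⟩ := exists_gap X u (u q)
    refine ⟨t', ?_, ?_⟩
    · have : X.filter (fun p => u p < t') = insert q (X.filter (fun p => u p < t)) := by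
        ext p
        simp only [Finset.mem_filter, Finset.mem_insert]
        constructor
        · rintro ⟨hp, hpt⟩
          by_cases hlt : u p < t
          · exact Or.inr ⟨hp, hlt⟩
          · left
            have := hmin p (Finset.mem_filter.2 ⟨hp, hlt⟩)
            rcases this.eq_or_lt with h | h
            · exact (hu hq.1 hp h).symm
            · exact absurd hpt (not_lt.2 (hgap p hp h).le)
        · rintro (rfl | ⟨hp, hpt⟩)
          · exact ⟨hq.1, ht'⟩
          · exact ⟨hp, by linarith [not_lt.1 hq.2]⟩
      rw [this, Finset.card_insert_of_notMem (by simp [hq.2]), h1]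
    · intro p hp h
      have := hgap p hp (by linarith)
      linarith

/-- The `m`-th smallest value depends continuously on the parameter. -/
lemma exists_level (A : Finset Pt) (g : ℝ → Pt → ℝ) (hg : ∀ p, Continuous fun s => g s p)
    (m : ℕ) (hm : 1 ≤ m) (hA : m ≤ A.card) :
    ∃ f : ℝ → ℝ, Continuous f ∧ ∀ s, (A.filter (fun p => g s p < f s)).card < m ∧
      m ≤ (A.filter (fun p => g s p ≤ f s)).card ∧ ∃ a ∈ A, g s a = f s := by
  classical
  have hne : (Finset.powersetCard m A).Nonempty := Finset.powersetCard_nonempty.2 hA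
  let h : Finset Pt → ℝ → ℝ := fun T s => if hT : T.Nonempty then T.sup' hT (g s) else 0
  refine ⟨fun s => (Finset.powersetCard m A).inf' hne (fun T => h T s), ?_, ?_⟩
  · refine Continuous.finset_inf'_apply hne fun T _ => ?_
    by_cases hT : T.Nonempty
    · simp only [h, hT, dif_pos]
      exact Continuous.finset_sup'_apply hT fun p _ => hg p
    · simp only [h, hT, dif_neg, not_false_eq_true]
      exact continuous_const
  · intro s
    beta_reduce
    obtain ⟨T, hT, hTe⟩ := Finset.exists_mem_eq_inf' hne (fun T => h T s)
    set v := (Finset.powersetCard m A).inf' hne (fun T => h T s) with hv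
    have hTc := Finset.mem_powersetCard.1 hT
    have hTn : T.Nonempty := by
      rw [← Finset.card_pos]
      omega
    have hTe' : v = T.sup' hTn (g s) := by
      rw [hTe]
      simp only [h, hTn, dif_pos]
    have c1 : (A.filter (fun p => g s p < v)).card < m := by
      by_contra hcon
      obtain ⟨T', hT', hc'⟩ := Finset.exists_subset_card_eq (not_lt.1 hcon)
      have hT'n : T'.Nonempty := by
        rw [← Finset.card_pos]
        omega
      have h1 : v ≤ h T' s := Finset.inf'_le (fun T => h T s)
        (Finset.mem_powersetCard.2 ⟨hT'.trans (Finset.filter_subset _ _), hc'⟩)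
      have h2 : h T' s < v := by
        simp only [h, hT'n, dif_pos]
        rw [Finset.sup'_lt_iff]
        intro p hp
        exact (Finset.mem_filter.1 (hT' hp)).2
      linarith
    have c2 : m ≤ (A.filter (fun p => g s p ≤ v)).card := by
      rw [← hTc.2]
      refine Finset.card_le_card fun p hp => Finset.mem_filter.2 ⟨hTc.1 hp, ?_⟩
      rw [hTe']
      exact Finset.le_sup' (g s) hp
    refine ⟨c1, c2, ?_⟩
    by_contra hcon
    push Not at hcon
    have : A.filter (fun p => g s p ≤ v) ⊆ A.filter (fun p => g s p < v) := by
      intro p hp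
      rw [Finset.mem_filter] at hp ⊢
      exact ⟨hp.1, lt_of_le_of_ne hp.2 (hcon p hp.1)⟩
    have := Finset.card_le_card this
    omega

/-- Discrete ham sandwich cut for separated sets. -/
lemma ham (X A B : Finset Pt) (hX : GenPos ↑X) (hAX : A ⊆ X) (hBX : B ⊆ X) (ε u₀ : ℝ)
    (hA : ∀ p ∈ A, p.1 + ε * p.2 < u₀) (hB : ∀ p ∈ B, u₀ < p.1 + ε * p.2)
    (m : ℕ) (hm : 1 ≤ m) (hmA : m ≤ A.card) (hmB : m ≤ B.card) :
    ∃ a b c : ℝ, (a ≠ 0 ∨ b ≠ 0) ∧ (∀ p ∈ X, a * p.1 + b * p.2 ≠ c) ∧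
      (A.filter (fun p => a * p.1 + b * p.2 < c)).card = m ∧
      (B.filter (fun p => a * p.1 + b * p.2 < c)).card = m := by
  classical
  let g : ℝ → Pt → ℝ := fun s p => (-s) * p.1 + (1 - s * ε) * p.2
  have hg : ∀ p, Continuous fun s => g s p := by
    intro p
    simp only [g]
    fun_prop
  obtain ⟨fA, cA, pA⟩ := exists_level A g hg m hm hmA
  obtain ⟨fB, cB, pB⟩ := exists_level B g hg m hm hmB
  have hz : (0 : ℝ) ∈ range (fun s => fA s - fB s) := by
    refine mem_range_of_exists_le_of_exists_ge (cA.sub cB) ?_ ?_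
    · have : ∀ᶠ s in Filter.atBot, ∀ p ∈ A, ∀ q ∈ B, g s p ≤ g s q := by
        rw [Filter.eventually_all_finset]
        intro p hp
        rw [Filter.eventually_all_finset]
        intro q hq
        have hpos : 0 < (q.1 + ε * q.2) - (p.1 + ε * p.2) := by linarith [hA p hp, hB q hq]
        filter_upwards [Filter.eventually_lt_atBot
          ((q.2 - p.2) / ((q.1 + ε * q.2) - (p.1 + ε * p.2)))] with s hs
        rw [lt_div_iff₀ hpos] at hs
        simp only [g]
        linarith
      obtain ⟨s, hs⟩ := this.exists
      obtain ⟨p, hp, hpe⟩ := (pA s).2.2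
      obtain ⟨q, hq, hqe⟩ := (pB s).2.2
      exact ⟨s, by linarith [hs p hp q hq]⟩
    · have : ∀ᶠ s in Filter.atTop, ∀ p ∈ A, ∀ q ∈ B, g s q ≤ g s p := by
        rw [Filter.eventually_all_finset]
        intro p hp
        rw [Filter.eventually_all_finset]
        intro q hq
        have hpos : 0 < (q.1 + ε * q.2) - (p.1 + ε * p.2) := by linarith [hA p hp, hB q hq]
        filter_upwards [Filter.eventually_gt_atTop
          ((q.2 - p.2) / ((q.1 + ε * q.2) - (p.1 + ε * p.2)))] with s hs
        rw [div_lt_iff₀ hpos] at hs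
        simp only [g]
        linarith
      obtain ⟨s, hs⟩ := this.exists
      obtain ⟨p, hp, hpe⟩ := (pA s).2.2
      obtain ⟨q, hq, hqe⟩ := (pB s).2.2
      exact ⟨s, by linarith [hs p hp q hq]⟩
  obtain ⟨s, hs⟩ := hz
  have hs : fB s = fA s := by
    have : fA s - fB s = 0 := hs
    linarith
  obtain ⟨a1, a2, a, haA, ha⟩ := pA s
  obtain ⟨b1, b2, b, hbB, hb⟩ := pB s
  rw [hs] at b1 b2 hb
  set t := fA s
  have hnz : -s ≠ 0 ∨ 1 - s * ε ≠ 0 := by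
    by_cases h : s = 0
    · right
      simp [h]
    · left
      simpa using h
  have hdisj : ∀ p ∈ A, ∀ q ∈ B, p ≠ q := by
    rintro p hp q hq rfl
    linarith [hA p hp, hB p hq]
  obtain ⟨t', ht', hgap⟩ := exists_gap X (g s) t
  have hcount : ∀ (S : Finset Pt) (e : Pt), S ⊆ X → e ∈ S → 
      (∀ p ∈ S, g s p = t → p = e) → (S.filter (fun p => g s p < t)).card < m →
      m ≤ (S.filter (fun p => g s p ≤ t)).card →
      (S.filter (fun p => g s p < t')).card = m := by
    intro S e hSX he hun hlt hle
    have h1 : S.filter (fun p => g s p < t') = S.filter (fun p => g s p ≤ t) := by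
      refine Finset.filter_congr fun p hp => ?_
      constructor
      · intro h
        by_contra hcon
        linarith [hgap p (hSX hp) (not_le.1 hcon)]
      · intro h
        linarith
    have h2 : S.filter (fun p => g s p ≤ t) ⊆ insert e (S.filter (fun p => g s p < t)) := by
      intro p hp
      rw [Finset.mem_filter] at hp
      rw [Finset.mem_insert, Finset.mem_filter]
      rcases hp.2.eq_or_lt with h | h
      · exact Or.inl (hun p hp.1 h)
      · exact Or.inr ⟨hp.1, h⟩
    have h3 := Finset.card_le_card h2
    have h4 := Finset.card_insert_le e (S.filter (fun p => g s p < t))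
    rw [h1]
    omega
  refine ⟨-s, 1 - s * ε, t', hnz, ?_, ?_, ?_⟩
  · intro p hp h
    have h : g s p = t' := h
    have := hgap p hp (by linarith)
    linarith
  · refine hcount A a hAX haA ?_ a1 a2
    intro p hp hpt
    by_contra hne
    exact hX.not_on_line (hAX hp) (hAX haA) (hBX hbB) hne (hdisj p hp b hbB)
      (hdisj a haA b hbB) hnz hpt ha hb
  · refine hcount B b hBX hbB ?_ b1 b2
    intro p hp hpt
    by_contra hne
    exact hX.not_on_line (hBX hp) (hBX hbB) (hAX haA) hne (hdisj a haA p hp).symm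
      (hdisj a haA b hbB).symm hnz hpt hb ha

/-- A preconnected set missing a line lies on one side of it. -/
lemma one_side {D : Set Pt} (hD : IsPreconnected D) {a b c : ℝ}
    (h : ∀ p ∈ D, a * p.1 + b * p.2 ≠ c) :
    (∀ p ∈ D, a * p.1 + b * p.2 < c) ∨ (∀ p ∈ D, c < a * p.1 + b * p.2) := by
  by_contra hcon
  push Not at hcon
  obtain ⟨⟨p, hp, hpc⟩, ⟨q, hq, hqc⟩⟩ := hcon
  have hcont : Continuous fun p : Pt => a * p.1 + b * p.2 := by fun_prop
  obtain ⟨x, hx, hxc⟩ := hD.intermediate_value hq hp hcont.continuousOn ⟨hqc, hpc⟩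
  exact h x hx hxc

open Classical in
lemma cuts (X : Finset Pt) (hX : GenPos ↑X) (ε u₀ : ℝ) (m : ℕ) (hm : 1 ≤ m) (k : ℕ) :
    ∀ A B : Finset Pt, A ⊆ X → B ⊆ X → (∀ p ∈ A, p.1 + ε * p.2 < u₀) →
      (∀ p ∈ B, u₀ < p.1 + ε * p.2) → A.card ≤ B.card → B.card ≤ A.card + 1 →
      B.card ≤ (k + 1) * m →
      ∃ L : Finset (Set Pt), L.card ≤ k ∧
        (∀ l ∈ L, IsAffLine l ∧ Disjoint l (↑X : Set Pt)) ∧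
        ∀ D : Set Pt, IsPreconnected D → D ⊆ (⋃₀ (↑L : Set (Set Pt)))ᶜ →
          (A.filter (· ∈ D)).card ≤ m ∧ (B.filter (· ∈ D)).card ≤ m := by
  induction k with
  | zero =>
    intro A B _ _ _ _ h1 h2 h3
    refine ⟨∅, by simp, by simp, fun D _ _ => ?_⟩
    have := Finset.card_filter_le A (· ∈ D)
    have := Finset.card_filter_le B (· ∈ D)
    constructor <;> omega
  | succ k ih =>
    intro A B hAX hBX hA hB h1 h2 h3
    by_cases hBm : B.card ≤ m
    · refine ⟨∅, by simp, by simp, fun D _ _ => ?_⟩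
      have := Finset.card_filter_le A (· ∈ D)
      have := Finset.card_filter_le B (· ∈ D)
      constructor <;> omega
    obtain ⟨a, b, c, hab, hon, cA, cB⟩ := ham X A B hX hAX hBX ε u₀ hA hB m hm (by omega) (by omega)
    have eA := Finset.card_filter_add_card_filter_not (s := A) (fun p => a * p.1 + b * p.2 < c)
    have eB := Finset.card_filter_add_card_filter_not (s := B) (fun p => a * p.1 + b * p.2 < c)
    obtain ⟨L, hLc, hL, hD⟩ := ih (A.filter (fun p => ¬ a * p.1 + b * p.2 < c))
      (B.filter (fun p => ¬ a * p.1 + b * p.2 < c))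
      ((Finset.filter_subset _ _).trans hAX) ((Finset.filter_subset _ _).trans hBX)
      (fun p hp => hA p (Finset.mem_filter.1 hp).1) (fun p hp => hB p (Finset.mem_filter.1 hp).1)
      (by omega) (by omega) (by
        have : (k + 1 + 1) * m = (k + 1) * m + m := by ring
        omega)
    refine ⟨insert {p : Pt | a * p.1 + b * p.2 = c} L, ?_, ?_, ?_⟩
    · exact (Finset.card_insert_le _ _).trans (by omega)
    · intro l hl
      rw [Finset.mem_insert] at hl
      rcases hl with rfl | hl
      · refine ⟨⟨a, b, c, hab, rfl⟩, ?_⟩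
        rw [Set.disjoint_left]
        exact fun p hp hpX => hon p hpX hp
      · exact hL l hl
    · intro D hDc hDL
      have hside := one_side hDc (a := a) (b := b) (c := c) (by
        intro p hp h
        exact hDL hp ⟨{p : Pt | a * p.1 + b * p.2 = c}, by simp, h⟩)
      rcases hside with hs | hs
      · constructor
        · rw [← cA]
          refine Finset.card_le_card fun p hp => ?_
          rw [Finset.mem_filter] at hp ⊢
          exact ⟨hp.1, hs p hp.2⟩
        · rw [← cB]
          refine Finset.card_le_card fun p hp => ?_
          rw [Finset.mem_filter] at hp ⊢
          exact ⟨hp.1, hs p hp.2⟩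
      · have := hD D hDc (hDL.trans (compl_subset_compl.2 (sUnion_subset_sUnion (by simp))))
        constructor
        · refine le_trans (Finset.card_le_card fun p hp => ?_) this.1
          simp only [Finset.mem_filter] at hp ⊢
          exact ⟨⟨hp.1, not_lt.2 (hs p hp.2).le⟩, hp.2⟩
        · refine le_trans (Finset.card_le_card fun p hp => ?_) this.2
          simp only [Finset.mem_filter] at hp ⊢
          exact ⟨⟨hp.1, not_lt.2 (hs p hp.2).le⟩, hp.2⟩

lemma exists_generic (X : Finset Pt) : ∃ ε : ℝ, (X : Set Pt).InjOn fun p => p.1 + ε * p.2 := by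
  classical
  obtain ⟨ε, hε⟩ := Infinite.exists_notMem_finset
    ((X ×ˢ X).image fun z : Pt × Pt => -(z.1.1 - z.2.1) / (z.1.2 - z.2.2))
  refine ⟨ε, fun p hp q hq h => ?_⟩
  have h : p.1 + ε * p.2 = q.1 + ε * q.2 := h
  by_cases h2 : p.2 - q.2 = 0
  · have : p.2 = q.2 := by linarith
    rw [this] at h
    exact Prod.ext (by linarith) this
  · exfalso
    apply hε
    rw [Finset.mem_image]
    refine ⟨(p, q), Finset.mem_product.2 ⟨hp, hq⟩, ?_⟩
    simp only
    rw [div_eq_iff h2]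
    linarith

lemma infinite_lines (X : Finset Pt) :
    {l : Set Pt | IsAffLine l ∧ Disjoint l (↑X : Set Pt)}.Infinite := by
  classical
  have h1 : ((X.image Prod.fst : Finset ℝ) : Set ℝ)ᶜ.Infinite :=
    (Finset.finite_toSet _).infinite_compl
  refine Set.infinite_of_injOn_mapsTo (f := fun c : ℝ => {p : Pt | (1 : ℝ) * p.1 + 0 * p.2 = c})
    ?_ ?_ h1
  · intro c _ d _ h
    have : ((c, 0) : Pt) ∈ {p : Pt | (1 : ℝ) * p.1 + 0 * p.2 = d} := by
      have h' : {p : Pt | (1 : ℝ) * p.1 + 0 * p.2 = c} = {p : Pt | (1 : ℝ) * p.1 + 0 * p.2 = d} := h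
      rw [← h']
      simp
    simpa using this
  · intro c hc
    refine ⟨⟨1, 0, c, by simp, rfl⟩, ?_⟩
    rw [Set.disjoint_left]
    intro p hp hpX
    apply hc
    have : p.1 = c := by simpa using hp
    simp only [Finset.coe_image]
    exact ⟨p, hpX, this⟩

lemma part_two (X : Finset Pt) (N : ℕ) (hN : X.card = N) (hN1 : 1 ≤ N) (hgp : GenPos ↑X)
    (K : ℕ) (hK : 1 ≤ K) :
    ∃ L : Finset (Set Pt), L.card = K ∧
        (∀ l ∈ L, IsAffLine l ∧ Disjoint l (↑X : Set Pt)) ∧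
        ∀ cell, IsCell ↑L cell →
          ((((↑X : Set Pt) ∩ cell).ncard : ℤ)) ≤ ⌈(N : ℝ) / (2 * K)⌉ := by
  classical
  have hK1 : (1 : ℝ) ≤ K := by exact_mod_cast hK
  have hN1' : (1 : ℝ) ≤ N := by exact_mod_cast hN1
  obtain ⟨m, hm⟩ : ∃ m : ℕ, (m : ℤ) = ⌈(N : ℝ) / (2 * K)⌉ :=
    ⟨_, Int.toNat_of_nonneg (Int.ceil_nonneg (by positivity))⟩
  have hm1 : 1 ≤ m := by
    have : 0 < ⌈(N : ℝ) / (2 * K)⌉ := Int.ceil_pos.2 (by positivity)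
    omega
  have hNm : N ≤ 2 * (K * m) := by
    have h := Int.le_ceil ((N : ℝ) / (2 * K))
    rw [← hm, div_le_iff₀ (by positivity)] at h
    have : (N : ℝ) ≤ ((2 * (K * m) : ℕ) : ℝ) := by
      push_cast at h ⊢
      linarith
    exact_mod_cast this
  obtain ⟨ε, hε⟩ := exists_generic X
  obtain ⟨u₀, hc, hu⟩ := exists_thr X _ hε (N / 2) (by omega)
  have e := Finset.card_filter_add_card_filter_not (s := X) (fun p => p.1 + ε * p.2 < u₀)
  obtain ⟨k, rfl⟩ : ∃ k, K = k + 1 := ⟨K - 1, by omega⟩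
  obtain ⟨L, hLc, hL, hD⟩ := cuts X hgp ε u₀ m hm1 k (X.filter (fun p => p.1 + ε * p.2 < u₀))
    (X.filter (fun p => ¬ p.1 + ε * p.2 < u₀)) (Finset.filter_subset _ _) (Finset.filter_subset _ _)
    (fun p hp => (Finset.mem_filter.1 hp).2)
    (fun p hp => lt_of_le_of_ne (not_lt.1 (Finset.mem_filter.1 hp).2)
      (hu p (Finset.mem_filter.1 hp).1).symm)
    (by omega) (by omega) (by omega)
  set l₀ : Set Pt := {p : Pt | 1 * p.1 + ε * p.2 = u₀} with hl₀
  obtain ⟨L', hLL', hL', hcard⟩ := (infinite_lines X).exists_superset_ncard_eq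
    (s := ((insert l₀ L : Finset (Set Pt)) : Set (Set Pt))) (k := k + 1) (by
      intro l hl
      have hl : l ∈ insert l₀ L := hl
      rw [Finset.mem_insert] at hl
      rcases hl with rfl | hl
      · refine ⟨⟨1, ε, u₀, by simp, rfl⟩, ?_⟩
        rw [Set.disjoint_left]
        intro p hp hpX
        have hp : 1 * p.1 + ε * p.2 = u₀ := hp
        exact hu p hpX (by linarith)
      · exact hL l hl) (Finset.finite_toSet _) (by
      rw [Set.ncard_coe_finset]
      exact (Finset.card_insert_le _ _).trans (by omega))
  have hfin : L'.Finite := Set.finite_of_ncard_pos (by omega)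
  refine ⟨hfin.toFinset, ?_, ?_, ?_⟩
  · rw [← hcard, Set.ncard_eq_toFinset_card _ hfin]
  · intro l hl
    exact hL' (hfin.mem_toFinset.1 hl)
  · rintro cell ⟨p, -, rfl⟩
    rw [hfin.coe_toFinset]
    set D := connectedComponentIn (⋃₀ L')ᶜ p
    have hDc : IsPreconnected D := isPreconnected_connectedComponentIn
    have hDL : D ⊆ (⋃₀ L')ᶜ := connectedComponentIn_subset _ _
    have hDD := hD D hDc (hDL.trans (compl_subset_compl.2 (sUnion_subset_sUnion
      (subset_trans (by simp) hLL'))))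
    have hside := one_side hDc (a := 1) (b := ε) (c := u₀) (by
        intro p hp h
        exact hDL hp ⟨l₀, hLL' (by simp), h⟩)
    rw [← hm]
    norm_cast
    rcases hside with hs | hs
    · refine le_trans ?_ hDD.1
      rw [← Set.ncard_coe_finset]
      refine Set.ncard_le_ncard ?_ (Finset.finite_toSet _)
      rintro q ⟨hq, hqD⟩
      have hq : q ∈ X := hq
      have := hs q hqD
      simp only [Finset.coe_filter, Finset.mem_filter, mem_setOf_eq]
      exact ⟨⟨hq, by linarith⟩, hqD⟩
    · refine le_trans ?_ hDD.2
      rw [← Set.ncard_coe_finset]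
      refine Set.ncard_le_ncard ?_ (Finset.finite_toSet _)
      rintro q ⟨hq, hqD⟩
      have hq : q ∈ X := hq
      have := hs q hqD
      simp only [Finset.coe_filter, Finset.mem_filter, mem_setOf_eq]
      exact ⟨⟨hq, by linarith⟩, hqD⟩

/-- Corollary 2.2.3. -/
theorem stmt_4 (c : ℝ) (hc0 : 0 < c) (hc1 : c ≤ 1) (X Y : Finset Pt) (N : ℕ)
    (hN : X.card = N) (hgp : GenPos ↑X) (hYX : Y ⊆ X)
    (hYc : c * N ≤ (Y.card : ℝ)) (hY3 : 3 ≤ Y.card) (hcp : ConvexPos ↑Y)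
    (K : ℕ) (hK : 1 ≤ K) :
    (∀ L : Finset (Set Pt), L.card = K →
        (∀ l ∈ L, IsAffLine l ∧ Disjoint l (↑X : Set Pt)) →
        ∃ cell, IsCell ↑L cell ∧
          c * N / (2 * K) ≤ ((((↑X : Set Pt) ∩ cell).ncard : ℝ))) ∧
    (∃ L : Finset (Set Pt), L.card = K ∧
        (∀ l ∈ L, IsAffLine l ∧ Disjoint l (↑X : Set Pt)) ∧
        ∀ cell, IsCell ↑L cell →
          ((((↑X : Set Pt) ∩ cell).ncard : ℤ)) ≤ ⌈(N : ℝ) / (2 * K)⌉) := by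
  refine ⟨fun L hLK hL => part_one c X Y N hgp hYX hYc hY3 hcp K hK L hLK hL, ?_⟩
  refine part_two X N hN ?_ hgp K hK
  have := Finset.card_le_card hYX
  omega
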